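/- Let m = 2 and n ≥ 1, and let ξ ∈ ℝ^{n×2} be totally irrational with best approximation sequences (X_i), (L_i). Assume ξ satisfies both Property (B) and Property (C), and assume in addition that the two-dimensional subspace 𝔏_ξ = {(𝒙, ξ𝒙) : 𝒙 ∈ ℝ²} of ℝ^{2+n} is not contained in any three-dimensional rational linear subspace of ℝ^{2+n}. Then the uniform exponent satisfies ω̂(ξ) ≤ 4/3. -/

import Mathlib

open Filter

/-- The sup-norm of the `i`-th integer vector `x i`, viewed in `ℝ^m`. -/
noncomputable def Xval {m : ℕ} (x : ℕ → Fin m → ℤ) (i : ℕ) : ℝ :=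
  ‖(fun j => (x i j : ℝ))‖

/-- The sup-norm of the remainder `ξ 𝒙ᵢ − 𝒚ᵢ`. -/
noncomputable def Lval {m n : ℕ} (ξ : Matrix (Fin n) (Fin m) ℝ)
    (x : ℕ → Fin m → ℤ) (y : ℕ → Fin n → ℤ) (i : ℕ) : ℝ :=
  ‖(ξ.mulVec (fun j => (x i j : ℝ)) - (fun k => (y i k : ℝ)))‖

/-- `ξ` is totally irrational: `‖ξ𝒙 − 𝒚‖ > 0` for every nonzero integer pair `(𝒙,𝒚)`. -/
def TotallyIrrational {m n : ℕ} (ξ : Matrix (Fin n) (Fin m) ℝ) : Prop :=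
  ∀ (u : Fin m → ℤ) (v : Fin n → ℤ), (u, v) ≠ 0 →
    0 < ‖(ξ.mulVec (fun j => (u j : ℝ)) - (fun k => (v k : ℝ)))‖

/-- `(𝒙ᵢ, 𝒚ᵢ)_{i}` is a sequence of best approximation vectors for `ξ`
(with respect to the sup norms). -/
structure IsBestApproxSeq {m n : ℕ} (ξ : Matrix (Fin n) (Fin m) ℝ)
    (x : ℕ → Fin m → ℤ) (y : ℕ → Fin n → ℤ) : Prop where
  nonzero : ∀ i, x i ≠ 0
  first : Xval x 0 = 1
  xStrictMono : StrictMono (Xval x)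
  lStrictAnti : StrictAnti (Lval ξ x y)
  best : ∀ (i : ℕ) (u : Fin m → ℤ) (v : Fin n → ℤ), u ≠ 0 →
    ‖(fun j => (u j : ℝ))‖ < Xval x (i + 1) →
    Lval ξ x y i ≤ ‖(ξ.mulVec (fun j => (u j : ℝ)) - (fun k => (v k : ℝ)))‖

/-- Property (A): `ξ` is badly approximable. -/
def PropA {m n : ℕ} (ξ : Matrix (Fin n) (Fin m) ℝ) : Prop :=
  ∃ c : ℝ, 0 < c ∧ ∀ (u : Fin m → ℤ) (v : Fin n → ℤ), u ≠ 0 →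
    c ≤ ‖(fun j => (u j : ℝ))‖ ^ m *
        ‖(ξ.mulVec (fun j => (u j : ℝ)) - (fun k => (v k : ℝ)))‖ ^ n

/-- Property (B): the ratios `X_{i+1}/X_i` are bounded. -/
def PropB {m : ℕ} (x : ℕ → Fin m → ℤ) : Prop :=
  ∃ M : ℝ, ∀ i : ℕ, Xval x (i + 1) / Xval x i ≤ M

/-- Property (C): the ratios `L_i/L_{i+1}` are bounded. -/
def PropC {m n : ℕ} (ξ : Matrix (Fin n) (Fin m) ℝ)
    (x : ℕ → Fin m → ℤ) (y : ℕ → Fin n → ℤ) : Prop :=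
  ∃ M : ℝ, ∀ i : ℕ, Lval ξ x y i / Lval ξ x y (i + 1) ≤ M

/-- The ordinary exponent `ω(ξ) = limsup (−log Lᵢ)/(log Xᵢ)`, as a value in `[0,+∞]`. -/
noncomputable def ordExp {m n : ℕ} (ξ : Matrix (Fin n) (Fin m) ℝ)
    (x : ℕ → Fin m → ℤ) (y : ℕ → Fin n → ℤ) : EReal :=
  limsup (fun i => ((-Real.log (Lval ξ x y i) / Real.log (Xval x i) : ℝ) : EReal)) atTop

/-- The uniform exponent `ω̂(ξ) = liminf (−log Lᵢ)/(log X_{i+1})`, as a value in `[0,+∞]`. -/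
noncomputable def unifExp {m n : ℕ} (ξ : Matrix (Fin n) (Fin m) ℝ)
    (x : ℕ → Fin m → ℤ) (y : ℕ → Fin n → ℤ) : EReal :=
  liminf (fun i => ((-Real.log (Lval ξ x y i) / Real.log (Xval x (i + 1)) : ℝ) : EReal)) atTop

/-- A linear subspace of `ℝ² × ℝⁿ ≅ ℝ^{2+n}` is rational if it is spanned by vectors
with rational coordinates. -/
def RationalSubspace {n : ℕ} (W : Submodule ℝ ((Fin 2 → ℝ) × (Fin n → ℝ))) : Prop :=
  ∃ S : Set ((Fin 2 → ℝ) × (Fin n → ℝ)),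
    (∀ v ∈ S, (∀ j, ∃ q : ℚ, v.1 j = (q : ℝ)) ∧ (∀ k, ∃ q : ℚ, v.2 k = (q : ℝ))) ∧
    W = Submodule.span ℝ S

/-- A real matrix with linearly independent rows has a square submatrix with nonzero determinant. -/
theorem exists_det_ne_zero_of_linearIndependent {k : ℕ} {ι : Type*} [Fintype ι]
    (A : Matrix (Fin k) ι ℝ) (hA : LinearIndependent ℝ A.row) :
    ∃ σ : Fin k → ι, (Matrix.of fun i j => A i (σ j)).det ≠ 0 := by
  have hr : Module.finrank ℝ (Submodule.span ℝ (Set.range A.col)) = k := by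
    rw [← Matrix.rank_eq_finrank_span_cols, hA.rank_matrix, Fintype.card_fin]
  have hcol := Submodule.exists_fun_fin_finrank_span_eq ℝ (Set.range A.col)
  rw [hr] at hcol
  obtain ⟨f, hf, -, hli⟩ := hcol
  choose σ hσ using hf
  refine ⟨σ, ?_⟩
  have hcols : LinearIndependent ℝ (Matrix.of fun i j => A i (σ j)).col := by
    have hfσ : (Matrix.of fun i j => A i (σ j)).col = f := funext hσ
    rwa [hfσ]
  have hu := Matrix.linearIndependent_cols_iff_isUnit.1 hcols
  exact ((Matrix.isUnit_iff_isUnit_det _).1 hu).ne_zero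

/-- An integer-valued family of linearly independent vectors whose members lie close to a subspace
of dimension at most `d` cannot be too small. -/
theorem exists_const_le_of_linearIndependent_int {V ι : Type*} [NormedAddCommGroup V]
    [NormedSpace ℝ V] [Fintype ι] (c : V →ₗ[ℝ] ι → ℝ) (hc : Function.Injective c)
    (hcn : ∀ v, ‖c v‖ ≤ ‖v‖) (k d : ℕ) :
    ∃ C : ℝ, 0 < C ∧ ∀ (K : Submodule ℝ V), Module.Finite ℝ K → Module.finrank ℝ K ≤ d →
      ∀ u v : Fin k → V, LinearIndependent ℝ (u + v) →
      (∀ i j, ∃ a : ℤ, c (u i + v i) j = a) → (∀ i, u i ∈ K) →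
      ∀ (b : Fin k → ℝ) (X Y : ℝ), 0 < Y → Y ≤ X → d ≤ k → (∀ i, ‖u i‖ ≤ b i * X) →
      (∀ i, ‖v i‖ ≤ b i * Y) → 1 ≤ C * (∏ i, b i) * X ^ d * Y ^ (k - d) := by
  classical
  refine ⟨2 ^ k * k.factorial, by positivity, ?_⟩
  intro K hKf hK u v hli hcoord huK b X Y hY hYX hdk hu hv
  have hX : 0 < X := hY.trans_le hYX
  have hb : ∀ i, 0 ≤ b i := fun i =>
    nonneg_of_mul_nonneg_left ((norm_nonneg _).trans (hv i)) hY
  obtain ⟨σ, hσ⟩ := exists_det_ne_zero_of_linearIndependent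
    (Matrix.of fun i => c ((u + v) i)) (hli.map' c (LinearMap.ker_eq_bot.2 hc))
  let f : V [⋀^Fin k]→ₗ[ℝ] ℝ :=
    (Matrix.detRowAlternating (n := Fin k) (R := ℝ)).compLinearMap
      ((LinearMap.funLeft ℝ ℝ σ).comp c)
  have hf : ∀ w, f w = (Matrix.of fun i j => c (w i) (σ j)).det := fun w => rfl
  have hbound : ∀ w : Fin k → V, |f w| ≤ k.factorial * ∏ i, ‖w i‖ := by
    intro w
    rw [hf, Matrix.det_apply]
    refine (Finset.abs_sum_le_sum_abs _ _).trans ?_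
    have : ∀ τ ∈ (Finset.univ : Finset (Equiv.Perm (Fin k))),
        |Equiv.Perm.sign τ • ∏ i, (Matrix.of fun i j => c (w i) (σ j)) (τ i) i|
          ≤ ∏ i, ‖w i‖ := by
      intro τ _
      have h1 : |Equiv.Perm.sign τ • ∏ i, (Matrix.of fun i j => c (w i) (σ j)) (τ i) i|
          = ∏ i, |c (w (τ i)) (σ i)| := by
        rw [← Finset.abs_prod]
        rcases Int.units_eq_one_or (Equiv.Perm.sign τ) with h | h <;> simp [h]
      rw [h1, ← Equiv.prod_comp τ (fun i => ‖w i‖)]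
      refine Finset.prod_le_prod (fun _ _ => abs_nonneg _) fun i _ => ?_
      exact (norm_le_pi_norm (c (w (τ i))) (σ i)).trans (hcn _)
    refine (Finset.sum_le_sum this).trans ?_
    simp [Fintype.card_perm]
  have h1 : 1 ≤ |f (u + v)| := by
    choose a ha using hcoord
    have : f (u + v) = (((Matrix.of fun i j => a i (σ j)).det : ℤ) : ℝ) := by
      rw [hf, Int.cast_det]
      congr 1
      ext i j
      simp [← ha]
    have hne : f (u + v) ≠ 0 := by rw [hf]; exact hσ
    rw [this] at hne ⊢
    exact_mod_cast Int.one_le_abs (by exact_mod_cast hne)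
  have hterm : ∀ s ∈ (Finset.univ : Finset (Finset (Fin k))),
      |f (s.piecewise u v)| ≤ k.factorial * ((∏ i, b i) * (X ^ d * Y ^ (k - d))) := by
    intro s _
    by_cases hs : s.card ≤ d
    · refine (hbound _).trans ?_
      gcongr
      have h2 : ∏ i, ‖s.piecewise u v i‖ ≤ ∏ i, (b i * (if i ∈ s then X else Y)) := by
        refine Finset.prod_le_prod (fun _ _ => norm_nonneg _) fun i _ => ?_
        by_cases his : i ∈ s
        · simpa [his] using hu i
        · simpa [his] using hv i
      refine h2.trans ?_
      rw [Finset.prod_mul_distrib]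
      refine mul_le_mul_of_nonneg_left ?_ (Finset.prod_nonneg fun i _ => hb i)
      rw [Finset.prod_ite]
      simp only [Finset.prod_const, Finset.filter_mem_eq_inter, Finset.univ_inter]
      have hcard : (Finset.univ.filter fun i => i ∉ s).card = k - s.card := by
        rw [Finset.filter_not, Finset.filter_mem_eq_inter, Finset.univ_inter,
          ← Finset.compl_eq_univ_sdiff, Finset.card_compl, Fintype.card_fin]
      rw [hcard]
      obtain ⟨e, rfl⟩ := Nat.exists_eq_add_of_le hs
      rw [show k - s.card = e + (k - (s.card + e)) by omega, pow_add, pow_add, mul_assoc]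
      gcongr
    · have h0 : f (s.piecewise u v) = 0 := by
        refine f.map_linearDependent _ fun hl => hs ?_
        have hl2 : LinearIndependent ℝ (fun i : s => (⟨u i, huK i⟩ : K)) := by
          refine LinearIndependent.of_comp K.subtype ?_
          have h3 : s.piecewise u v ∘ (fun i : s => (i : Fin k)) = fun i : s => u i := by
            ext i
            simp
          have h4 := hl.comp (fun i : s => (i : Fin k)) Subtype.val_injective
          rw [h3] at h4
          exact h4
        have := hl2.fintype_card_le_finrank
        simpa using this.trans hK
      rw [h0, abs_zero]
      have := Finset.prod_nonneg fun i (_ : i ∈ Finset.univ) => hb i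
      positivity
  have hsum : f (u + v) = ∑ s : Finset (Fin k), f (s.piecewise u v) :=
    f.toMultilinearMap.map_add_univ u v
  rw [hsum] at h1
  refine h1.trans ((Finset.abs_sum_le_sum_abs _ _).trans ((Finset.sum_le_sum hterm).trans ?_))
  simp only [Finset.sum_const, Finset.card_univ, Fintype.card_finset, Fintype.card_fin,
    nsmul_eq_mul, Nat.cast_pow, Nat.cast_ofNat]
  apply le_of_eq
  ring

theorem exists_abs_eq_norm {ι : Type*} [Fintype ι] [Nonempty ι] (v : ι → ℝ) :
    ∃ i, |v i| = ‖v‖ := by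
  obtain ⟨i, hi⟩ := Finite.exists_max fun i => |v i|
  exact ⟨i, le_antisymm (norm_le_pi_norm v i)
    ((pi_norm_le_iff_of_nonneg (abs_nonneg _)).2 hi)⟩

/-- If all mixed `2 × 2` minors of two vectors are small, then the sum or the difference of the two
vectors is short in both components. -/
theorem exists_short_combination {ι κ : Type*} [Fintype ι] [Fintype κ] [Nonempty ι] [Nonempty κ]
    (x x' : ι → ℝ) (r r' : κ → ℝ) (hx : ‖x‖ ≤ ‖x'‖) (hr : ‖r'‖ ≤ ‖r‖) (hx' : 0 < ‖x'‖)
    (hr0 : 0 < ‖r‖) (h : ∀ e f, |x e * r' f - x' e * r f| < ‖x'‖ * ‖r‖ / 3) :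
    ∃ σ : ℤ, (σ = 1 ∨ σ = -1) ∧ ‖x' - (σ : ℝ) • x‖ < ‖x'‖ ∧ ‖r' - (σ : ℝ) • r‖ < ‖r‖ := by
  obtain ⟨e, he⟩ := exists_abs_eq_norm x'
  obtain ⟨f, hf⟩ := exists_abs_eq_norm r
  have he0 : x' e ≠ 0 := fun h0 => by simp [h0] at he; exact hx'.ne he
  have hf0 : r f ≠ 0 := fun h0 => by simp [h0] at hf; exact hr0.ne hf
  obtain ⟨t, ht⟩ : ∃ t, x e = t * x' e := ⟨x e / x' e, by field_simp⟩
  obtain ⟨s, hs⟩ : ∃ s, r' f = s * r f := ⟨r' f / r f, by field_simp⟩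
  have ht1 : |t| ≤ 1 := by
    have := (norm_le_pi_norm x e).trans hx
    rw [Real.norm_eq_abs, ht, abs_mul, he] at this
    nlinarith
  have hs1 : |s| ≤ 1 := by
    have := (norm_le_pi_norm r' f).trans hr
    rw [Real.norm_eq_abs, hs, abs_mul, hf] at this
    nlinarith
  have hA : ∀ g, |r g - t * r' g| < ‖r‖ / 3 := by
    intro g
    have := h e g
    rw [ht, show t * x' e * r' g - x' e * r g = -(x' e * (r g - t * r' g)) by ring, abs_neg,
      abs_mul, he] at this
    refine lt_of_mul_lt_mul_left ?_ hx'.le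
    linarith
  have hB : ∀ g, |x' g - s * x g| < ‖x'‖ / 3 := by
    intro g
    have := h g f
    rw [hs, show x g * (s * r f) - x' g * r f = -(r f * (x' g - s * x g)) by ring, abs_neg,
      abs_mul, hf] at this
    refine lt_of_mul_lt_mul_left ?_ hr0.le
    linarith
  have hts : |1 - t * s| < 1 / 3 := by
    have := hA f
    rw [hs, show r f - t * (s * r f) = r f * (1 - t * s) by ring, abs_mul, hf] at this
    nlinarith
  have hts' := abs_lt.1 hts
  rw [abs_le] at ht1 hs1
  have key : ∀ τ : ℝ, |τ| = 1 → |τ - t| < 1 / 3 → |τ - s| < 1 / 3 →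
      ‖x' - τ • x‖ < ‖x'‖ ∧ ‖r' - τ • r‖ < ‖r‖ := by
    intro τ hτ h1 h2
    have hττ : τ * τ = 1 := by rw [← abs_mul_abs_self, hτ, one_mul]
    refine ⟨(pi_norm_lt_iff hx').2 fun g => ?_, (pi_norm_lt_iff hr0).2 fun g => ?_⟩
    · have hxg := (norm_le_pi_norm x g).trans hx
      rw [Real.norm_eq_abs] at hxg ⊢
      have h3 : (x' - τ • x) g = (x' g - s * x g) - (τ - s) * x g := by simp; ring
      have h4 : |(τ - s) * x g| ≤ 1 / 3 * ‖x'‖ := by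
        rw [abs_mul]; gcongr
      rw [h3]
      have := abs_sub (x' g - s * x g) ((τ - s) * x g)
      linarith [hB g]
    · have hrg := (norm_le_pi_norm r' g).trans hr
      rw [Real.norm_eq_abs] at hrg ⊢
      have h3 : (r' - τ • r) g = -τ * (r g - t * r' g) + τ * (τ - t) * r' g := by
        simp only [Pi.sub_apply, Pi.smul_apply, smul_eq_mul]
        linear_combination (-r' g) * hττ
      have h4 : |τ * (τ - t) * r' g| ≤ 1 / 3 * ‖r‖ := by
        rw [abs_mul, abs_mul, hτ, one_mul]; gcongr
      have h5 : |-τ * (r g - t * r' g)| < ‖r‖ / 3 := by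
        rw [abs_mul, abs_neg, hτ, one_mul]; exact hA g
      rw [h3]
      have := abs_add_le (-τ * (r g - t * r' g)) (τ * (τ - t) * r' g)
      linarith
  rcases le_or_gt 0 t with h0 | h0
  · refine ⟨1, Or.inl rfl, ?_⟩
    rw [Int.cast_one]
    refine key 1 (by simp) ?_ ?_ <;> rw [abs_lt] <;> constructor <;> nlinarith
  · refine ⟨-1, Or.inr rfl, ?_⟩
    rw [Int.cast_neg, Int.cast_one]
    refine key (-1) (by simp) ?_ ?_ <;> rw [abs_lt] <;> constructor <;> nlinarith

section Geometry

variable {n : ℕ}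

/-- The integer vector `(u, v)`, viewed in `ℝ² × ℝⁿ`. -/
def intVec (u : Fin 2 → ℤ) (v : Fin n → ℤ) : (Fin 2 → ℝ) × (Fin n → ℝ) :=
  (fun j => (u j : ℝ), fun k => (v k : ℝ))

/-- The remainder map `(𝒙, 𝒚) ↦ ξ𝒙 − 𝒚`. -/
def remainder (ξ : Matrix (Fin n) (Fin 2) ℝ) :
    (Fin 2 → ℝ) × (Fin n → ℝ) →ₗ[ℝ] (Fin n → ℝ) :=
  ξ.mulVecLin ∘ₗ LinearMap.fst ℝ _ _ - LinearMap.snd ℝ _ _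

/-- The plane `{(𝒙, ξ𝒙)}`. -/
def graphPlane (ξ : Matrix (Fin n) (Fin 2) ℝ) : Submodule ℝ ((Fin 2 → ℝ) × (Fin n → ℝ)) :=
  LinearMap.range ((LinearMap.id : (Fin 2 → ℝ) →ₗ[ℝ] (Fin 2 → ℝ)).prod ξ.mulVecLin)

theorem remainder_apply (ξ : Matrix (Fin n) (Fin 2) ℝ) (w : (Fin 2 → ℝ) × (Fin n → ℝ)) :
    remainder ξ w = ξ.mulVec w.1 - w.2 := rfl

theorem mem_graphPlane_iff (ξ : Matrix (Fin n) (Fin 2) ℝ) (w : (Fin 2 → ℝ) × (Fin n → ℝ)) :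
    w ∈ graphPlane ξ ↔ remainder ξ w = 0 := by
  rw [remainder_apply, sub_eq_zero, graphPlane, LinearMap.mem_range]
  constructor
  · rintro ⟨v, rfl⟩
    rfl
  · exact fun h => ⟨w.1, Prod.ext rfl h⟩

theorem finrank_graphPlane (ξ : Matrix (Fin n) (Fin 2) ℝ) :
    Module.finrank ℝ (graphPlane ξ) = 2 := by
  rw [graphPlane, LinearMap.finrank_range_of_inj, Module.finrank_fin_fun]
  exact fun a b h => congrArg Prod.fst h

/-- The coordinates on `ℝ² × ℝⁿ` as a single family. -/
def coordMap (n : ℕ) : (Fin 2 → ℝ) × (Fin n → ℝ) →ₗ[ℝ] (Fin 2 ⊕ Fin n → ℝ) where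
  toFun w := Sum.elim w.1 w.2
  map_add' a b := by ext (i | i) <;> rfl
  map_smul' a b := by ext (i | i) <;> rfl

theorem coordMap_injective : Function.Injective (coordMap n) := by
  intro a b h
  refine Prod.ext (funext fun j => ?_) (funext fun j => ?_)
  · exact congrFun h (Sum.inl j)
  · exact congrFun h (Sum.inr j)

theorem norm_coordMap_le (w : (Fin 2 → ℝ) × (Fin n → ℝ)) : ‖coordMap n w‖ ≤ ‖w‖ := by
  refine (pi_norm_le_iff_of_nonneg (norm_nonneg _)).2 ?_
  rintro (j | j)
  · exact (norm_le_pi_norm w.1 j).trans (norm_fst_le w)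
  · exact (norm_le_pi_norm w.2 j).trans (norm_snd_le w)

theorem coordMap_intVec (u : Fin 2 → ℤ) (v : Fin n → ℤ) (j : Fin 2 ⊕ Fin n) :
    ∃ a : ℤ, coordMap n (intVec u v) j = a := by
  rcases j with j | j
  · exact ⟨u j, rfl⟩
  · exact ⟨v j, rfl⟩

theorem exists_norm_mulVec_le (ξ : Matrix (Fin n) (Fin 2) ℝ) :
    ∃ A : ℝ, 1 ≤ A ∧ ∀ v, ‖ξ.mulVec v‖ ≤ A * ‖v‖ := by
  refine ⟨max 1 ‖LinearMap.toContinuousLinearMap ξ.mulVecLin‖, le_max_left _ _, fun v => ?_⟩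
  refine ((LinearMap.toContinuousLinearMap ξ.mulVecLin).le_opNorm v).trans ?_
  gcongr
  exact le_max_right _ _

/-- Linearly independent integer vectors with controlled size and remainder: lower bound coming
from the fact that the plane `{(𝒙, ξ𝒙)}` has dimension two. -/
theorem exists_const_le_of_intVec (ξ : Matrix (Fin n) (Fin 2) ℝ) (k : ℕ) (hk : 2 ≤ k) :
    ∃ C : ℝ, 0 < C ∧ ∀ (p : Fin k → Fin 2 → ℤ) (q : Fin k → Fin n → ℤ),
      LinearIndependent ℝ (fun i => intVec (p i) (q i)) →
      ∀ (b : Fin k → ℝ) (X Y : ℝ), 0 < Y → Y ≤ X →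
      (∀ i, ‖(intVec (p i) (q i)).1‖ ≤ b i * X) →
      (∀ i, ‖remainder ξ (intVec (p i) (q i))‖ ≤ b i * Y) →
      1 ≤ C * (∏ i, b i) * X ^ 2 * Y ^ (k - 2) := by
  obtain ⟨A, hA1, hA⟩ := exists_norm_mulVec_le ξ
  obtain ⟨C, hC0, hC⟩ := exists_const_le_of_linearIndependent_int (coordMap n)
    coordMap_injective norm_coordMap_le k 2
  refine ⟨C * A ^ k, by positivity, ?_⟩
  intro p q hli b X Y hY hYX hX hR
  have hX0 := hY.trans_le hYX
  have hb : ∀ i, 0 ≤ b i := fun i =>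
    nonneg_of_mul_nonneg_left ((norm_nonneg _).trans (hR i)) hY
  have hadd : ∀ i, ((intVec (p i) (q i)).1, ξ.mulVec (intVec (p i) (q i)).1)
      + ((0 : Fin 2 → ℝ), -remainder ξ (intVec (p i) (q i))) = intVec (p i) (q i) := by
    intro i
    refine Prod.ext ?_ ?_
    · simp
    · simp [remainder_apply]
  have h := hC (graphPlane ξ) inferInstance (finrank_graphPlane ξ).le
    (fun i => ((intVec (p i) (q i)).1, ξ.mulVec (intVec (p i) (q i)).1))
    (fun i => ((0 : Fin 2 → ℝ), -remainder ξ (intVec (p i) (q i))))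
    (by
      have h := hli
      rw [← funext hadd] at h
      exact h)
    (fun i j => by rw [hadd]; exact coordMap_intVec _ _ j)
    (fun i => by rw [mem_graphPlane_iff, remainder_apply]; simp)
    (fun i => A * b i) X Y hY hYX hk
    (fun i => by
      rw [Prod.norm_mk, max_le_iff]
      have h1 := hX i
      have h2 := hA (intVec (p i) (q i)).1
      have h3 := mul_nonneg (hb i) hX0.le
      constructor <;> nlinarith)
    (fun i => by
      rw [Prod.norm_mk, norm_zero, norm_neg, max_le_iff]
      have h1 := hR i
      have h3 := mul_nonneg (hb i) hY.le
      constructor <;> nlinarith)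
  rw [Finset.prod_mul_distrib, Finset.prod_const, Finset.card_univ, Fintype.card_fin] at h
  linarith

/-- Integer vectors in a subspace meeting the plane `{(𝒙, ξ𝒙)}` in at most a line: two independent
ones cannot both be small. -/
theorem exists_const_le_of_finrank_inf_le_one (ξ : Matrix (Fin n) (Fin 2) ℝ)
    (W : Submodule ℝ ((Fin 2 → ℝ) × (Fin n → ℝ)))
    (hW : Module.finrank ℝ (W ⊓ graphPlane ξ : Submodule ℝ _) ≤ 1) :
    ∃ C : ℝ, 0 < C ∧ ∀ (p : Fin 2 → Fin 2 → ℤ) (q : Fin 2 → Fin n → ℤ),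
      LinearIndependent ℝ (fun i => intVec (p i) (q i)) →
      (∀ i, intVec (p i) (q i) ∈ W) →
      ∀ (X Y : ℝ), 0 < Y → Y ≤ X →
      (∀ i, ‖(intVec (p i) (q i)).1‖ ≤ X) →
      (∀ i, ‖remainder ξ (intVec (p i) (q i))‖ ≤ Y) →
      1 ≤ C * X * Y := by
  obtain ⟨A, hA1, hA⟩ := exists_norm_mulVec_le ξ
  obtain ⟨C, hC0, hC⟩ := exists_const_le_of_linearIndependent_int (coordMap n)
    coordMap_injective norm_coordMap_le 2 1
  obtain ⟨g₀, hg₀⟩ := ((remainder ξ).domRestrict W).rangeRestrict.exists_rightInverse_of_surjective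
    (LinearMap.range_rangeRestrict _)
  obtain ⟨g, hg⟩ := LinearMap.exists_extend g₀
  have hRg : ∀ w ∈ W, remainder ξ (g (remainder ξ w) : W) = remainder ξ w := by
    intro w hw
    have h1 := congrArg Subtype.val
      (LinearMap.congr_fun hg₀ (((remainder ξ).domRestrict W).rangeRestrict ⟨w, hw⟩))
    rw [← hg] at h1
    exact h1
  set B := ‖LinearMap.toContinuousLinearMap (W.subtype ∘ₗ g)‖ with hBdef
  have hB : ∀ v, ‖((g v : W) : (Fin 2 → ℝ) × (Fin n → ℝ))‖ ≤ B * ‖v‖ :=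
    (LinearMap.toContinuousLinearMap (W.subtype ∘ₗ g)).le_opNorm
  have hB0 : 0 ≤ B := norm_nonneg _
  refine ⟨C * (A + 1 + B) ^ 2, by positivity, ?_⟩
  intro p q hli hmem X Y hY hYX hX hR
  have hX0 := hY.trans_le hYX
  have hnorm : ∀ i, ‖intVec (p i) (q i)‖ ≤ (A + 1) * X := by
    intro i
    have h1 := hX i
    have h2 := hR i
    have h3 := hA (intVec (p i) (q i)).1
    rw [Prod.norm_def, max_le_iff]
    refine ⟨by nlinarith, ?_⟩
    have h4 : (intVec (p i) (q i)).2
        = ξ.mulVec (intVec (p i) (q i)).1 - remainder ξ (intVec (p i) (q i)) := by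
      simp [remainder_apply]
    rw [h4]
    refine (norm_sub_le _ _).trans ?_
    nlinarith
  have hadd : ∀ i, (intVec (p i) (q i) - (g (remainder ξ (intVec (p i) (q i))) : W))
      + (g (remainder ξ (intVec (p i) (q i))) : W) = intVec (p i) (q i) := fun i =>
    sub_add_cancel _ _
  have h := hC (W ⊓ graphPlane ξ) inferInstance hW
    (fun i => intVec (p i) (q i) - (g (remainder ξ (intVec (p i) (q i))) : W))
    (fun i => (g (remainder ξ (intVec (p i) (q i))) : W))
    (by
      have h := hli
      rw [← funext hadd] at h
      exact h)
    (fun i j => by rw [hadd]; exact coordMap_intVec _ _ j)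
    (fun i => by
      refine ⟨W.sub_mem (hmem i) (Subtype.prop _), ?_⟩
      rw [SetLike.mem_coe, mem_graphPlane_iff, map_sub, hRg _ (hmem i), sub_self])
    (fun _ => A + 1 + B) X Y hY hYX one_le_two
    (fun i => by
      refine (norm_sub_le _ _).trans ?_
      have h1 := hnorm i
      have h2 := hB (remainder ξ (intVec (p i) (q i)))
      have h3 := mul_le_mul_of_nonneg_left ((hR i).trans hYX) hB0
      linarith)
    (fun i => by
      have h2 := hB (remainder ξ (intVec (p i) (q i)))
      have h3 := mul_le_mul_of_nonneg_left (hR i) hB0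
      nlinarith)
  simpa [mul_assoc] using h

end Geometry

namespace IsBestApproxSeq

variable {n : ℕ} {ξ : Matrix (Fin n) (Fin 2) ℝ} {x : ℕ → Fin 2 → ℤ} {y : ℕ → Fin n → ℤ}

theorem one_le_Xval (h : IsBestApproxSeq ξ x y) (i : ℕ) : 1 ≤ Xval x i :=
  h.first.symm.le.trans (h.xStrictMono.monotone (Nat.zero_le i))

theorem Lval_pos (h : IsBestApproxSeq ξ x y) (i : ℕ) : 0 < Lval ξ x y i :=
  (norm_nonneg _).trans_lt (h.lStrictAnti (Nat.lt_succ_self i))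

theorem natCast_le_Xval (h : IsBestApproxSeq ξ x y) (i : ℕ) : (i : ℝ) ≤ Xval x i := by
  have hN : ∀ i, ∃ N : ℕ, Xval x i = N := by
    intro i
    obtain ⟨e, he⟩ := exists_abs_eq_norm (fun j => (x i j : ℝ))
    refine ⟨(x i e).natAbs, ?_⟩
    rw [Xval, ← he, Nat.cast_natAbs, Int.cast_abs]
  choose N hN using hN
  have hmono : StrictMono N := by
    intro a b hab
    have := h.xStrictMono hab
    rw [hN, hN] at this
    exact_mod_cast this
  rw [hN]
  exact_mod_cast hmono.le_apply

/-- A mixed minor of two consecutive best approximations is comparable to `X_{i+1} L_i`. -/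
theorem exists_minor_ge (h : IsBestApproxSeq ξ x y) (hn : 1 ≤ n) (i : ℕ) :
    ∃ e f, Xval x (i + 1) * Lval ξ x y i / 3 ≤
      |(intVec (x i) (y i)).1 e * remainder ξ (intVec (x (i + 1)) (y (i + 1))) f -
        (intVec (x (i + 1)) (y (i + 1))).1 e * remainder ξ (intVec (x i) (y i)) f| := by
  by_contra! hcon
  have : Nonempty (Fin n) := ⟨⟨0, hn⟩⟩
  obtain ⟨σ, hσ, hX, hL⟩ := exists_short_combination (intVec (x i) (y i)).1
    (intVec (x (i + 1)) (y (i + 1))).1 (remainder ξ (intVec (x i) (y i)))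
    (remainder ξ (intVec (x (i + 1)) (y (i + 1))))
    (h.xStrictMono (Nat.lt_succ_self i)).le (h.lStrictAnti (Nat.lt_succ_self i)).le
    (one_pos.trans_le (h.one_le_Xval (i + 1))) (h.Lval_pos i) hcon
  have hz : intVec (x (i + 1) - σ • x i) (y (i + 1) - σ • y i)
      = intVec (x (i + 1)) (y (i + 1)) - (σ : ℝ) • intVec (x i) (y i) := by
    refine Prod.ext (funext fun j => ?_) (funext fun j => ?_) <;> simp [intVec]
  have hne : x (i + 1) - σ • x i ≠ 0 := by
    intro h0
    have h1 := h.xStrictMono (Nat.lt_succ_self i)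
    have h2 : ∀ j, |x (i + 1) j| = |x i j| := by
      intro j
      have := congrFun (sub_eq_zero.1 h0) j
      rw [this]
      rcases hσ with rfl | rfl <;> simp
    refine h1.ne ?_
    rw [Nat.succ_eq_add_one, Xval, Xval, Pi.norm_def, Pi.norm_def]
    congr 2
    funext j
    apply NNReal.eq
    simp only [coe_nnnorm, Real.norm_eq_abs]
    exact_mod_cast (h2 j).symm
  have hbest := h.best i _ (y (i + 1) - σ • y i) hne
    (by
      change ‖(intVec (x (i + 1) - σ • x i) (y (i + 1) - σ • y i)).1‖ < _
      rw [hz]; exact hX)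
  refine absurd hL (not_lt.2 ?_)
  change Lval ξ x y i ≤ ‖remainder ξ (intVec (x (i + 1) - σ • x i) (y (i + 1) - σ • y i))‖ at hbest
  rw [hz, map_sub, map_smul] at hbest
  exact hbest

theorem linearIndependent_pair (h : IsBestApproxSeq ξ x y) (hn : 1 ≤ n) (i : ℕ) :
    LinearIndependent ℝ ![intVec (x i) (y i), intVec (x (i + 1)) (y (i + 1))] := by
  rw [LinearIndependent.pair_iff]
  intro s t hst
  obtain ⟨e, f, hef⟩ := h.exists_minor_ge hn i
  have hpos : 0 < |(intVec (x i) (y i)).1 e * remainder ξ (intVec (x (i + 1)) (y (i + 1))) f -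
        (intVec (x (i + 1)) (y (i + 1))).1 e * remainder ξ (intVec (x i) (y i)) f| := by
    have := h.Lval_pos i
    have := h.one_le_Xval (i + 1)
    refine lt_of_lt_of_le ?_ hef
    positivity
  have h0 := abs_pos.1 hpos
  have h1 : s * (intVec (x i) (y i)).1 e + t * (intVec (x (i + 1)) (y (i + 1))).1 e = 0 :=
    congrFun (congrArg Prod.fst hst) e
  have h2 : s * remainder ξ (intVec (x i) (y i)) f
      + t * remainder ξ (intVec (x (i + 1)) (y (i + 1))) f = 0 := by
    have := congrFun (congrArg (remainder ξ) hst) f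
    rw [map_add, map_smul, map_smul, map_zero] at this
    exact this
  constructor
  · refine (mul_eq_zero.1 ?_).resolve_right h0
    linear_combination remainder ξ (intVec (x (i + 1)) (y (i + 1))) f * h1 -
      (intVec (x (i + 1)) (y (i + 1))).1 e * h2
  · refine (mul_eq_zero.1 ?_).resolve_right h0
    linear_combination (intVec (x i) (y i)).1 e * h2 - remainder ξ (intVec (x i) (y i)) f * h1

/-- Two consecutive best approximations form a basis of the integer points of their span. -/
theorem exists_int_combination (h : IsBestApproxSeq ξ x y) (i : ℕ)
    (hL : Lval ξ x y i < 1) (u : Fin 2 → ℤ) (v : Fin n → ℤ) (a b : ℝ)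
    (huv : intVec u v = a • intVec (x i) (y i) + b • intVec (x (i + 1)) (y (i + 1))) :
    ∃ a' b' : ℤ,
      intVec u v = (a' : ℝ) • intVec (x i) (y i) + (b' : ℝ) • intVec (x (i + 1)) (y (i + 1)) := by
  have hX1 := h.xStrictMono (Nat.lt_succ_self i)
  have hL1 := h.lStrictAnti (Nat.lt_succ_self i)
  rw [Nat.succ_eq_add_one] at hX1 hL1
  set u' := u - round a • x i - round b • x (i + 1) with hu'
  set v' := v - round a • y i - round b • y (i + 1) with hv'
  have hz : intVec u' v' = intVec u v - (round a : ℝ) • intVec (x i) (y i)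
      - (round b : ℝ) • intVec (x (i + 1)) (y (i + 1)) := by
    refine Prod.ext (funext fun j => ?_) (funext fun j => ?_) <;> simp [intVec, u', v']
  have hz' : intVec u' v' = (a - round a) • intVec (x i) (y i)
      + (b - round b) • intVec (x (i + 1)) (y (i + 1)) := by
    rw [hz, huv, sub_smul, sub_smul]
    abel
  have ha := abs_sub_round a
  have hb := abs_sub_round b
  have hnX : ‖(intVec u' v').1‖ < Xval x (i + 1) := by
    have h1 : (intVec u' v').1 = (a - round a) • (intVec (x i) (y i)).1
      + (b - round b) • (intVec (x (i + 1)) (y (i + 1))).1 := by rw [hz']; rfl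
    rw [h1]
    refine (norm_add_le _ _).trans_lt ?_
    rw [norm_smul, norm_smul, Real.norm_eq_abs, Real.norm_eq_abs]
    change |a - round a| * Xval x i + |b - round b| * Xval x (i + 1) < _
    have := h.one_le_Xval i
    nlinarith
  have hnL : ‖remainder ξ (intVec u' v')‖ < Lval ξ x y i := by
    rw [hz', map_add, map_smul, map_smul]
    refine (norm_add_le _ _).trans_lt ?_
    rw [norm_smul, norm_smul, Real.norm_eq_abs, Real.norm_eq_abs]
    change |a - round a| * Lval ξ x y i + |b - round b| * Lval ξ x y (i + 1) < _
    have := h.Lval_pos (i + 1)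
    nlinarith
  have hu0 : u' = 0 := by
    by_contra hne
    exact absurd hnL (not_lt.2 (h.best i u' v' hne hnX))
  have hv0 : v' = 0 := by
    funext k
    have h1 : remainder ξ (intVec u' v') = -fun k => (v' k : ℝ) := by
      rw [remainder_apply, hu0]
      simp [intVec, ← Pi.zero_def]
    have h2 : |(v' k : ℝ)| < 1 := by
      refine lt_of_le_of_lt ?_ (hnL.trans hL)
      rw [h1, norm_neg]
      exact norm_le_pi_norm (fun k => (v' k : ℝ)) k
    exact Int.abs_lt_one_iff.1 (by exact_mod_cast h2)
  refine ⟨round a, round b, ?_⟩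
  have h0 : intVec u' v' = 0 := by
    rw [hu0, hv0]
    refine Prod.ext (funext fun j => ?_) (funext fun j => ?_) <;> simp [intVec]
  rw [h0] at hz
  rw [sub_sub, eq_comm, sub_eq_zero] at hz
  exact hz

/-- If the plane spanned by two consecutive best approximations contains a later such pair, then the
products `X_{i+1} L_i` compare. -/
theorem Xval_mul_Lval_le (h : IsBestApproxSeq ξ x y) (hn : 1 ≤ n) (i r : ℕ)
    (hL : Lval ξ x y i < 1)
    (h1 : intVec (x r) (y r) ∈
      Submodule.span ℝ {intVec (x i) (y i), intVec (x (i + 1)) (y (i + 1))})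
    (h2 : intVec (x (r + 1)) (y (r + 1)) ∈
      Submodule.span ℝ {intVec (x i) (y i), intVec (x (i + 1)) (y (i + 1))}) :
    Xval x (i + 1) * Lval ξ x y i ≤ 6 * (Xval x (r + 1) * Lval ξ x y r) := by
  obtain ⟨a₀, b₀, hab₀⟩ := Submodule.mem_span_pair.1 h1
  obtain ⟨c₀, d₀, hcd₀⟩ := Submodule.mem_span_pair.1 h2
  obtain ⟨a, b, hab⟩ := h.exists_int_combination i hL _ _ _ _ hab₀.symm
  obtain ⟨c, d, hcd⟩ := h.exists_int_combination i hL _ _ _ _ hcd₀.symm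
  obtain ⟨e, f, hef⟩ := h.exists_minor_ge hn i
  have hXr := h.xStrictMono (Nat.lt_succ_self r)
  have hLr := h.lStrictAnti (Nat.lt_succ_self r)
  rw [Nat.succ_eq_add_one] at hXr hLr
  have hX1 := h.one_le_Xval r
  have hL0 := h.Lval_pos (r + 1)
  have hfst : ∀ e, (intVec (x r) (y r)).1 e
      = a * (intVec (x i) (y i)).1 e + b * (intVec (x (i + 1)) (y (i + 1))).1 e :=
    fun e => congrFun (congrArg Prod.fst hab) e
  have hfst' : ∀ e, (intVec (x (r + 1)) (y (r + 1))).1 e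
      = c * (intVec (x i) (y i)).1 e + d * (intVec (x (i + 1)) (y (i + 1))).1 e :=
    fun e => congrFun (congrArg Prod.fst hcd) e
  have hrem : ∀ f, remainder ξ (intVec (x r) (y r)) f = a * remainder ξ (intVec (x i) (y i)) f
      + b * remainder ξ (intVec (x (i + 1)) (y (i + 1))) f := by
    intro f
    rw [hab, map_add, map_smul, map_smul]
    rfl
  have hrem' : ∀ f, remainder ξ (intVec (x (r + 1)) (y (r + 1))) f
      = c * remainder ξ (intVec (x i) (y i)) f
      + d * remainder ξ (intVec (x (i + 1)) (y (i + 1))) f := by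
    intro f
    rw [hcd, map_add, map_smul, map_smul]
    rfl
  have hminor : ∀ e f, (intVec (x r) (y r)).1 e
        * remainder ξ (intVec (x (r + 1)) (y (r + 1))) f -
        (intVec (x (r + 1)) (y (r + 1))).1 e * remainder ξ (intVec (x r) (y r)) f =
      ((a * d - b * c : ℤ) : ℝ) * ((intVec (x i) (y i)).1 e
        * remainder ξ (intVec (x (i + 1)) (y (i + 1))) f -
        (intVec (x (i + 1)) (y (i + 1))).1 e * remainder ξ (intVec (x i) (y i)) f) := by
    intro e f
    rw [hfst, hfst', hrem, hrem']
    push_cast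
    ring
  have hdet : a * d - b * c ≠ 0 := by
    intro h0
    obtain ⟨e', f', hef'⟩ := h.exists_minor_ge hn r
    rw [hminor, h0, Int.cast_zero, zero_mul, abs_zero] at hef'
    nlinarith [mul_pos (one_pos.trans_le (hX1.trans hXr.le)) (hL0.trans hLr)]
  have hdet1 : (1 : ℝ) ≤ |((a * d - b * c : ℤ) : ℝ)| := by
    exact_mod_cast Int.one_le_abs hdet
  have hle := hminor e f
  have hub : |(intVec (x r) (y r)).1 e * remainder ξ (intVec (x (r + 1)) (y (r + 1))) f -
        (intVec (x (r + 1)) (y (r + 1))).1 e * remainder ξ (intVec (x r) (y r)) f|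
      ≤ 2 * (Xval x (r + 1) * Lval ξ x y r) := by
    refine (abs_sub _ _).trans ?_
    rw [abs_mul, abs_mul]
    have e1 : |(intVec (x r) (y r)).1 e| ≤ Xval x (r + 1) :=
      (norm_le_pi_norm (intVec (x r) (y r)).1 e).trans hXr.le
    have e2 : |(intVec (x (r + 1)) (y (r + 1))).1 e| ≤ Xval x (r + 1) :=
      norm_le_pi_norm (intVec (x (r + 1)) (y (r + 1))).1 e
    have e3 : |remainder ξ (intVec (x r) (y r)) f| ≤ Lval ξ x y r :=
      norm_le_pi_norm (remainder ξ (intVec (x r) (y r))) f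
    have e4 : |remainder ξ (intVec (x (r + 1)) (y (r + 1))) f| ≤ Lval ξ x y r :=
      (norm_le_pi_norm (remainder ξ (intVec (x (r + 1)) (y (r + 1)))) f).trans hLr.le
    have p1 := mul_le_mul e1 e4 (abs_nonneg _) (by linarith)
    have p2 := mul_le_mul e2 e3 (abs_nonneg _) (by linarith)
    linarith
  rw [hle, abs_mul] at hub
  have := le_mul_of_one_le_left (abs_nonneg ((intVec (x i) (y i)).1 e
        * remainder ξ (intVec (x (i + 1)) (y (i + 1))) f -
        (intVec (x (i + 1)) (y (i + 1))).1 e * remainder ξ (intVec (x i) (y i)) f)) hdet1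
  linarith

end IsBestApproxSeq

/-- In a sequence of vectors that eventually leaves every three-dimensional subspace, there are
consecutive independent triples followed, after a stretch inside one plane, by a vector which is
independent of the triple. -/
theorem exists_linearIndependent_quadruple {V : Type*} [AddCommGroup V] [Module ℝ V] (z : ℕ → V)
    (hpair : ∀ i, LinearIndependent ℝ ![z i, z (i + 1)])
    (hesc : ∀ W : Submodule ℝ V, Module.Finite ℝ W → Module.finrank ℝ W ≤ 3 →
      ∀ N, ∃ i, N ≤ i ∧ z i ∉ W) (N : ℕ) :
    ∃ j r, N ≤ j ∧ j + 1 ≤ r ∧ LinearIndependent ℝ ![z j, z (j + 1), z (j + 2)] ∧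
      LinearIndependent ℝ ![z (r + 2), z j, z (j + 1), z (j + 2)] ∧
      z r ∈ Submodule.span ℝ {z (j + 1), z (j + 2)} ∧
      z (r + 1) ∈ Submodule.span ℝ {z (j + 1), z (j + 2)} := by
  classical
  have hrank : ∀ i, Module.finrank ℝ (Submodule.span ℝ {z i, z (i + 1)}) = 2 := by
    intro i
    have := finrank_span_eq_card (hpair i)
    rwa [Matrix.range_cons_cons_empty, Fintype.card_fin] at this
  have hspan : ∀ i (W : Submodule ℝ V), z i ∈ W → z (i + 1) ∈ W →
      Submodule.span ℝ {z i, z (i + 1)} ≤ W := by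
    intro i W h1 h2
    rw [Submodule.span_le]
    rintro w (rfl | rfl)
    exacts [h1, h2]
  have hfin : ∀ i, Module.Finite ℝ (Submodule.span ℝ {z i, z (i + 1)}) := fun i =>
    Module.Finite.span_of_finite ℝ (Set.toFinite _)
  have heq : ∀ i k, z i ∈ Submodule.span ℝ {z k, z (k + 1)} →
      z (i + 1) ∈ Submodule.span ℝ {z k, z (k + 1)} →
      Submodule.span ℝ {z i, z (i + 1)} = Submodule.span ℝ {z k, z (k + 1)} := by
    intro i k h1 h2
    have := hfin k
    exact Submodule.eq_of_le_of_finrank_eq (hspan i _ h1 h2) (by rw [hrank, hrank])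
  have hleft : ∀ i, z i ∈ Submodule.span ℝ {z i, z (i + 1)} := fun i =>
    Submodule.subset_span (Or.inl rfl)
  have hright : ∀ i, z (i + 1) ∈ Submodule.span ℝ {z i, z (i + 1)} := fun i =>
    Submodule.subset_span (Or.inr rfl)
  set P := Submodule.span ℝ {z N, z (N + 1)} with hP
  have hP_fin : Module.Finite ℝ P := hfin N
  have hexa := hesc P hP_fin (by rw [hP, hrank]; norm_num) N
  set a := Nat.find hexa with ha
  obtain ⟨haN, haP⟩ := Nat.find_spec hexa
  rw [← ha] at haN haP
  have hamin : ∀ i, N ≤ i → i < a → z i ∈ P := by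
    intro i hi hia
    by_contra hcon
    exact Nat.find_min hexa hia ⟨hi, hcon⟩
  set W := P ⊔ Submodule.span ℝ {z a} with hW
  have hPW : P ≤ W := le_sup_left
  have haW : z a ∈ W := Submodule.mem_sup_right (Submodule.mem_span_singleton_self _)
  have hWrank : Module.finrank ℝ W ≤ 3 := by
    have h1 := Submodule.finrank_add_le_finrank_add_finrank P (Submodule.span ℝ {z a})
    have h2 := finrank_span_le_card (R := ℝ) {z a}
    rw [Set.toFinset_singleton, Finset.card_singleton] at h2
    have h3 := hrank N
    rw [← hP] at h3
    rw [hW]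
    omega
  have hexb := hesc W inferInstance hWrank N
  set b := Nat.find hexb with hb
  obtain ⟨hbN, hbW⟩ := Nat.find_spec hexb
  rw [← hb] at hbN hbW
  have hbmin : ∀ i, N ≤ i → i < b → z i ∈ W := by
    intro i hi hia
    by_contra hcon
    exact Nat.find_min hexb hia ⟨hi, hcon⟩
  have hab : a < b := by
    rcases lt_trichotomy a b with h | h | h
    · exact h
    · exact absurd (h ▸ haW) hbW
    · exact absurd (hPW (hamin b hbN h)) hbW
  have haN2 : N + 2 ≤ a := by
    by_contra hlt
    obtain h | h : a = N ∨ a = N + 1 := by omega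
    · exact haP (h ▸ hleft N)
    · exact haP (h ▸ hright N)
  obtain ⟨r, hr⟩ := Nat.exists_eq_add_of_le' (show 2 ≤ b by omega)
  set Q := Submodule.span ℝ {z r, z (r + 1)} with hQ
  have hexj : ∃ i, i ≤ r + 1 ∧ N ≤ i ∧ z i ∉ Q := by
    by_contra! hcon
    have h1 := heq N r (hcon N (by omega) le_rfl) (hcon (N + 1) (by omega) (by omega))
    refine haP ?_
    rw [hP, h1]
    exact hcon a (by omega) haN
  obtain ⟨i₀, hi₀, hi₀'⟩ := hexj
  set j := Nat.findGreatest (fun i => N ≤ i ∧ z i ∉ Q) (r + 1) with hj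
  obtain ⟨hjN, hjQ⟩ : N ≤ j ∧ z j ∉ Q :=
    Nat.findGreatest_spec (P := fun i => N ≤ i ∧ z i ∉ Q) hi₀ hi₀'
  have hjle : j ≤ r + 1 := Nat.findGreatest_le _
  have hjmax : ∀ i, j < i → i ≤ r + 1 → z i ∈ Q := by
    intro i hji hir
    by_contra hcon
    exact Nat.findGreatest_is_greatest hji hir ⟨by omega, hcon⟩
  have hjr : j + 1 ≤ r := by
    by_contra hlt
    obtain h | h : j = r ∨ j = r + 1 := by omega
    · exact hjQ (h ▸ hleft r)
    · exact hjQ (h ▸ hright r)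
  have hQeq : Submodule.span ℝ {z (j + 1), z (j + 2)} = Q :=
    heq (j + 1) r (hjmax _ (by omega) (by omega)) (hjmax _ (by omega) (by omega))
  have hli3 : LinearIndependent ℝ ![z j, z (j + 1), z (j + 2)] := by
    refine linearIndependent_finCons.2 ⟨hpair (j + 1), ?_⟩
    rwa [Matrix.range_cons_cons_empty, hQeq]
  refine ⟨j, r, hjN, hjr, hli3, linearIndependent_finCons.2 ⟨hli3, ?_⟩, ?_, ?_⟩
  · rw [← hr]
    refine fun hmem => hbW (Submodule.span_le.2 ?_ hmem)
    rintro w ⟨i, rfl⟩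
    fin_cases i
    exacts [hbmin _ (by omega) (by omega), hbmin _ (by omega) (by omega),
      hbmin _ (by omega) (by omega)]
  · rw [hQeq]; exact hleft r
  · rw [hQeq]; exact hright r

namespace IsBestApproxSeq

variable {n : ℕ} {ξ : Matrix (Fin n) (Fin 2) ℝ} {x : ℕ → Fin 2 → ℤ} {y : ℕ → Fin n → ℤ}

theorem eventually_lt_log_Xval (h : IsBestApproxSeq ξ x y) (B : ℝ) :
    ∀ᶠ i in atTop, B < Real.log (Xval x i) :=
  ((Real.tendsto_log_atTop.comp
    (tendsto_atTop_mono h.natCast_le_Xval tendsto_natCast_atTop_atTop)).eventually_gt_atTop B)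

/-- If the uniform exponent exceeds one, then the best approximations do not eventually lie in a
subspace of dimension at most three. -/
theorem exists_notMem_of_finrank_le_three (h : IsBestApproxSeq ξ x y) (hn : 1 ≤ n)
    (hrat : ¬ ∃ W : Submodule ℝ ((Fin 2 → ℝ) × (Fin n → ℝ)),
        RationalSubspace W ∧ Module.finrank ℝ W = 3 ∧ graphPlane ξ ≤ W)
    {ω : ℝ} (hω1 : 1 < ω)
    (hω : ∀ᶠ i in atTop, Real.log (Lval ξ x y i) ≤ -ω * Real.log (Xval x (i + 1)))
    (W : Submodule ℝ ((Fin 2 → ℝ) × (Fin n → ℝ))) (hW : Module.finrank ℝ W ≤ 3) (N : ℕ) :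
    ∃ i, N ≤ i ∧ intVec (x i) (y i) ∉ W := by
  by_contra! hcon
  set S : Set ((Fin 2 → ℝ) × (Fin n → ℝ)) := {w | ∃ i, N ≤ i ∧ w = intVec (x i) (y i)} with hS
  set V := Submodule.span ℝ S with hV
  have hzV : ∀ i, N ≤ i → intVec (x i) (y i) ∈ V := fun i hi =>
    Submodule.subset_span ⟨i, hi, rfl⟩
  have hVW : V ≤ W := by
    rw [hV, Submodule.span_le]
    rintro w ⟨i, hi, rfl⟩
    exact hcon i hi
  have hV3 : Module.finrank ℝ V ≤ 3 := (Submodule.finrank_mono hVW).trans hW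
  by_cases hle : graphPlane ξ ≤ V
  · have hlt : graphPlane ξ < V := by
      refine lt_of_le_of_ne hle fun heq => ?_
      have h1 := hzV N le_rfl
      rw [← heq, mem_graphPlane_iff] at h1
      have h2 := h.Lval_pos N
      change 0 < ‖remainder ξ (intVec (x N) (y N))‖ at h2
      rw [h1, norm_zero] at h2
      exact h2.false
    have h3 := Submodule.finrank_lt_finrank_of_lt hlt
    rw [finrank_graphPlane] at h3
    refine hrat ⟨V, ⟨S, ?_, rfl⟩, by omega, hle⟩
    rintro w ⟨i, -, rfl⟩
    exact ⟨fun j => ⟨x i j, by simp [intVec]⟩, fun k => ⟨y i k, by simp [intVec]⟩⟩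
  · have hlt : V ⊓ graphPlane ξ < graphPlane ξ :=
      lt_of_le_of_ne inf_le_right fun heq => hle (inf_eq_right.1 heq)
    have h3 := Submodule.finrank_lt_finrank_of_lt hlt
    rw [finrank_graphPlane] at h3
    obtain ⟨C, hC0, hC⟩ := exists_const_le_of_finrank_inf_le_one ξ V (by omega)
    obtain ⟨i, hi, hiN, hiX⟩ := (hω.and ((eventually_ge_atTop N).and
      ((tendsto_add_atTop_nat 1).eventually
        (h.eventually_lt_log_Xval (max 0 (Real.log C / (ω - 1))))))).exists
    obtain ⟨hX0, hXC⟩ := max_lt_iff.1 hiX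
    have hX1 := h.one_le_Xval (i + 1)
    have hL0 := h.Lval_pos i
    have hL1 : Lval ξ x y i ≤ 1 := by
      rw [← Real.log_nonpos_iff hL0.le]
      nlinarith
    have hX := h.xStrictMono (Nat.lt_succ_self i)
    have hL := h.lStrictAnti (Nat.lt_succ_self i)
    have hli := h.linearIndependent_pair hn i
    have key := hC ![x i, x (i + 1)] ![y i, y (i + 1)]
      (by
        convert hli using 1
        ext k <;> fin_cases k <;> rfl)
      (fun k => by
        fin_cases k
        exacts [hzV i hiN, hzV (i + 1) (by omega)])
      (Xval x (i + 1)) (Lval ξ x y i) hL0 (hL1.trans hX1)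
      (fun k => by
        fin_cases k
        exacts [hX.le, le_rfl])
      (fun k => by
        fin_cases k
        exacts [le_rfl, hL.le])
    have hlog := Real.log_nonneg key
    rw [Real.log_mul (by positivity) hL0.ne', Real.log_mul hC0.ne' (by positivity)] at hlog
    rw [div_lt_iff₀ (by linarith)] at hXC
    nlinarith

/-- The bounded ratios in (B) and (C) admit a common bound. -/
theorem exists_ratio_bound (h : IsBestApproxSeq ξ x y) (hB : PropB x) (hC : PropC ξ x y) :
    ∃ M : ℝ, 1 ≤ M ∧ (∀ i, Xval x (i + 1) ≤ M * Xval x i) ∧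
      ∀ i, Lval ξ x y i ≤ M * Lval ξ x y (i + 1) := by
  obtain ⟨A, hA⟩ := hB
  obtain ⟨B, hB⟩ := hC
  refine ⟨max 1 (max A B), le_max_left _ _, fun i => ?_, fun i => ?_⟩
  · have h0 : 0 < Xval x i := zero_lt_one.trans_le (h.one_le_Xval i)
    exact (div_le_iff₀ h0).1 ((hA i).trans ((le_max_left A B).trans (le_max_right 1 _)))
  · exact (div_le_iff₀ (h.Lval_pos _)).1
      ((hB i).trans ((le_max_right A B).trans (le_max_right 1 _)))

/-- An exponent for which the uniform approximation inequality holds is at most `4 / 3`, provided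
that the best approximations do not eventually lie in a subspace of dimension at most three. -/
theorem exponent_le_four_thirds (h : IsBestApproxSeq ξ x y) (hn : 1 ≤ n)
    (hB : PropB x) (hC : PropC ξ x y)
    (hesc : ∀ W : Submodule ℝ ((Fin 2 → ℝ) × (Fin n → ℝ)), Module.finrank ℝ W ≤ 3 →
      ∀ N, ∃ i, N ≤ i ∧ intVec (x i) (y i) ∉ W)
    {ω : ℝ} (hω2 : ω ≤ 3 / 2)
    (hω : ∀ᶠ i in atTop, Real.log (Lval ξ x y i) ≤ -ω * Real.log (Xval x (i + 1))) :
    ω ≤ 4 / 3 := by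
  by_contra! hω1
  obtain ⟨M, hM1, hMX, hML⟩ := h.exists_ratio_bound hB hC
  obtain ⟨C₃, hC₃0, hC₃⟩ := exists_const_le_of_intVec ξ 3 (by norm_num)
  obtain ⟨C₄, hC₄0, hC₄⟩ := exists_const_le_of_intVec ξ 4 (by norm_num)
  set D := (3 - 2 * ω) * (Real.log C₃ + 3 * Real.log M) +
    (ω - 1) * (Real.log C₄ + 4 * Real.log M) + Real.log 6 with hD
  obtain ⟨N, hN⟩ := eventually_atTop.1
    (hω.and (h.eventually_lt_log_Xval (max 0 (D / (3 * ω - 4)))))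
  obtain ⟨j, r, hNj, hjr, hli3, hli4, hr1, hr2⟩ := exists_linearIndependent_quadruple
    (fun i => intVec (x i) (y i)) (h.linearIndependent_pair hn) (fun W _ hW => hesc W hW) N
  obtain ⟨hωk, hpk⟩ := hN (j + 1) (by omega)
  obtain ⟨hωr, -⟩ := hN r (by omega)
  obtain ⟨hp0, hpD⟩ := max_lt_iff.1 hpk
  rw [div_lt_iff₀ (by linarith)] at hpD
  have hX1 := h.one_le_Xval (j + 1)
  have hX0 : 0 < Xval x (j + 1) := by linarith
  have hL0 := h.Lval_pos (j + 1)
  have hS1 := h.one_le_Xval (r + 1)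
  have hS0 : 0 < Xval x (r + 1) := by linarith
  have hT0 := h.Lval_pos r
  have hM0 : 0 < M := by linarith
  have hXS : Xval x (j + 1) ≤ Xval x (r + 1) := h.xStrictMono.monotone (by omega)
  have hXX : Xval x (j + 1) < Xval x (j + 2) := h.xStrictMono (by omega)
  have hLlt : Lval ξ x y (j + 1) < 1 := by
    rw [← Real.log_neg_iff hL0]
    have : 0 < Real.log (Xval x (j + 1 + 1)) := hp0.trans (Real.log_lt_log hX0 hXX)
    nlinarith
  have hLX : Lval ξ x y (j + 1) ≤ Xval x (j + 1) := hLlt.le.trans hX1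
  have hmulX : Xval x (j + 1) ≤ M * Xval x (j + 1) := le_mul_of_one_le_left hX0.le hM1
  have hmulL : Lval ξ x y (j + 1) ≤ M * Lval ξ x y (j + 1) := le_mul_of_one_le_left hL0.le hM1
  have hjX : Xval x j ≤ M * Xval x (j + 1) := (h.xStrictMono.monotone (by omega)).trans hmulX
  have hjL : Lval ξ x y (j + 2) ≤ M * Lval ξ x y (j + 1) :=
    (h.lStrictAnti.antitone (by omega)).trans hmulL
  have hrX : Xval x (r + 2) ≤ M * Xval x (r + 1) / Xval x (j + 1) * Xval x (j + 1) := by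
    rw [div_mul_cancel₀ _ hX0.ne']
    exact hMX (r + 1)
  have hrL : Lval ξ x y (r + 2) ≤ M * Xval x (r + 1) / Xval x (j + 1) * Lval ξ x y (j + 1) := by
    refine (h.lStrictAnti.antitone (by omega : j + 1 ≤ r + 2)).trans
      (le_mul_of_one_le_left hL0.le ?_)
    rw [one_le_div hX0]
    exact hXS.trans (le_mul_of_one_le_left hS0.le hM1)
  have e3 := hC₃ ![x j, x (j + 1), x (j + 2)] ![y j, y (j + 1), y (j + 2)]
    (by
      refine Eq.subst (motive := fun v => LinearIndependent ℝ v) (funext fun k => ?_) hli3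
      fin_cases k <;> rfl)
    ![M, M, M] (Xval x (j + 1)) (Lval ξ x y (j + 1)) hL0 hLX
    (fun k => by
      fin_cases k
      exacts [hjX, hmulX, hMX (j + 1)])
    (fun k => by
      fin_cases k
      exacts [hML j, hmulL, hjL])
  have e4 := hC₄ ![x (r + 2), x j, x (j + 1), x (j + 2)] ![y (r + 2), y j, y (j + 1), y (j + 2)]
    (by
      refine Eq.subst (motive := fun v => LinearIndependent ℝ v) (funext fun k => ?_) hli4
      fin_cases k <;> rfl)
    ![M * Xval x (r + 1) / Xval x (j + 1), M, M, M]
    (Xval x (j + 1)) (Lval ξ x y (j + 1)) hL0 hLX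
    (fun k => by
      fin_cases k
      exacts [hrX, hjX, hmulX, hMX (j + 1)])
    (fun k => by
      fin_cases k
      exacts [hrL, hML j, hmulL, hjL])
  have e5 := (mul_le_mul_of_nonneg_right hXX.le hL0.le).trans
    (h.Xval_mul_Lval_le hn (j + 1) r hLlt hr1 hr2)
  have l3 : 0 ≤ Real.log C₃ + 3 * Real.log M + 2 * Real.log (Xval x (j + 1)) +
      Real.log (Lval ξ x y (j + 1)) := by
    have e : C₃ * (∏ i, ![M, M, M] i) * Xval x (j + 1) ^ 2 * Lval ξ x y (j + 1) ^ (3 - 2) =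
        C₃ * M ^ 3 * Xval x (j + 1) ^ 2 * Lval ξ x y (j + 1) := by
      rw [Fin.prod_univ_three]
      change C₃ * (M * M * M) * Xval x (j + 1) ^ 2 * Lval ξ x y (j + 1) ^ 1 = _
      ring
    have hlog := Real.log_nonneg (e3.trans_eq e)
    rw [Real.log_mul (by positivity) hL0.ne', Real.log_mul (by positivity) (by positivity),
      Real.log_mul hC₃0.ne' (by positivity), Real.log_pow, Real.log_pow] at hlog
    exact_mod_cast hlog
  have l4 : 0 ≤ Real.log C₄ + 4 * Real.log M + Real.log (Xval x (r + 1)) +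
      Real.log (Xval x (j + 1)) + 2 * Real.log (Lval ξ x y (j + 1)) := by
    have e : C₄ * (∏ i, ![M * Xval x (r + 1) / Xval x (j + 1), M, M, M] i) *
        Xval x (j + 1) ^ 2 * Lval ξ x y (j + 1) ^ (4 - 2) =
        C₄ * M ^ 4 * Xval x (r + 1) * Xval x (j + 1) * Lval ξ x y (j + 1) ^ 2 := by
      rw [Fin.prod_univ_four]
      change C₄ * (M * Xval x (r + 1) / Xval x (j + 1) * M * M * M) * Xval x (j + 1) ^ 2 *
        Lval ξ x y (j + 1) ^ 2 = _
      field_simp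
    have hlog := Real.log_nonneg (e4.trans_eq e)
    rw [Real.log_mul (by positivity) (by positivity), Real.log_mul (by positivity) hX0.ne',
      Real.log_mul (by positivity) hS0.ne', Real.log_mul hC₄0.ne' (by positivity), Real.log_pow,
      Real.log_pow] at hlog
    exact_mod_cast hlog
  have l5 : Real.log (Xval x (j + 1)) + Real.log (Lval ξ x y (j + 1)) ≤
      Real.log 6 - (ω - 1) * Real.log (Xval x (r + 1)) := by
    have hlog := Real.log_le_log (by positivity) e5
    rw [Real.log_mul hX0.ne' hL0.ne', Real.log_mul (by norm_num) (by positivity),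
      Real.log_mul hS0.ne' hT0.ne'] at hlog
    linarith
  have m3 := mul_nonneg (show 0 ≤ 3 - 2 * ω by linarith) l3
  have m4 := mul_nonneg (show 0 ≤ ω - 1 by linarith) l4
  linarith

end IsBestApproxSeq

/-- For `m = 2, n ≥ 1`: if `ξ` satisfies (B) and (C) and the plane
`𝔏_ξ = {(𝒙, ξ𝒙)}` is not contained in any three-dimensional rational subspace,
then `ω̂(ξ) ≤ 4/3`. -/
theorem stmt_18 (n : ℕ) (hn : 1 ≤ n)
    (ξ : Matrix (Fin n) (Fin 2) ℝ) (hirr : TotallyIrrational ξ)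
    (x : ℕ → Fin 2 → ℤ) (y : ℕ → Fin n → ℤ) (hxy : IsBestApproxSeq ξ x y)
    (hB : PropB x) (hC : PropC ξ x y)
    (hrat : ¬ ∃ W : Submodule ℝ ((Fin 2 → ℝ) × (Fin n → ℝ)),
        RationalSubspace W ∧ Module.finrank ℝ W = 3 ∧
        LinearMap.range
          ((LinearMap.id : (Fin 2 → ℝ) →ₗ[ℝ] (Fin 2 → ℝ)).prod ξ.mulVecLin) ≤ W) :
    unifExp ξ x y ≤ (((4 : ℝ) / 3) : EReal) := by
  by_contra! hlt
  obtain ⟨ω, hω1, hω⟩ := EReal.lt_iff_exists_real_btwn.1 hlt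
  have hω1 : 4 / 3 < ω := EReal.coe_lt_coe_iff.1 hω1
  have hlog : ∀ᶠ i in atTop, Real.log (Lval ξ x y i) ≤
      -(min ω (3 / 2)) * Real.log (Xval x (i + 1)) := by
    filter_upwards [eventually_lt_of_lt_liminf hω, (tendsto_add_atTop_nat 1).eventually
      (hxy.eventually_lt_log_Xval 0)] with i hi hi0
    have hi' := (lt_div_iff₀ hi0).1 (EReal.coe_lt_coe_iff.1 hi)
    have := mul_le_mul_of_nonneg_right (min_le_left ω (3 / 2)) hi0.le
    linarith
  have hmin : 4 / 3 < min ω (3 / 2) := lt_min hω1 (by norm_num)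
  exact hmin.not_ge (hxy.exponent_le_four_thirds hn hB hC
    (hxy.exists_notMem_of_finrank_le_three hn hrat (by linarith) hlog) (min_le_right _ _) hlog)
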